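/- arXiv:2410.12706 — 7 statements merged into one kernel-verified Lean document; each statement's English description precedes it below -/
import Mathlib

section
/- Let d_A, d_B, r be positive natural numbers. Let λ : Fin r → ℝ satisfy λ_k ≥ 0 for all k and Σ_k λ_k = 1, let u : Fin r → ℂ^{d_A} and v : Fin r → ℂ^{d_B} be orthonormal families, and define ψ : Fin d_A → Fin d_B → ℂ by ψ(i,j) = Σ_k √(λ_k) · u_k(i) · v_k(j). Then the maximum of λ over Fin r is the greatest element of the set { |Σ_{i,j} conj(a_i) · conj(b_j) · ψ(i,j)|² : a ∈ ℂ^{d_A}, b ∈ ℂ^{d_B}, ‖a‖ = 1, ‖b‖ = 1 }; i.e., every squared overlap of ψ with a unit product state is at most max_k λ_k, and this value is attained. -/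
theorem aux_bessel {r d : ℕ} (w : Fin r → Fin d → ℂ)
    (hw : ∀ k l, ∑ i, starRingEnd ℂ (w k i) * w l i = if k = l then 1 else 0)
    (a : Fin d → ℂ) (ha : ∑ i, ‖a i‖ ^ 2 = 1) :
    ∑ k, ‖∑ i, starRingEnd ℂ (a i) * w k i‖ ^ 2 ≤ 1 := by
  have ho : Orthonormal ℂ (fun k => (WithLp.toLp 2 (w k) : EuclideanSpace ℂ (Fin d))) := by
    rw [orthonormal_iff_ite]
    intro k l
    rw [← hw k l]
    simp [PiLp.inner_apply, mul_comm]
  have h := ho.sum_inner_products_le (WithLp.toLp 2 a : EuclideanSpace ℂ (Fin d))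
    (s := Finset.univ)
  rw [EuclideanSpace.norm_sq_eq] at h
  simp only [ha] at h
  refine le_trans (le_of_eq ?_) h
  refine Finset.sum_congr rfl fun k _ => ?_
  rw [norm_inner_symm]
  simp [PiLp.inner_apply, mul_comm]

theorem aux_overlap {dA dB r : ℕ} (lam : Fin r → ℝ)
    (u : Fin r → Fin dA → ℂ) (v : Fin r → Fin dB → ℂ)
    (ψ : Fin dA → Fin dB → ℂ)
    (hψ : ∀ i j, ψ i j = ∑ k, (Real.sqrt (lam k) : ℂ) * u k i * v k j)
    (a : Fin dA → ℂ) (b : Fin dB → ℂ) :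
    ∑ i, ∑ j, starRingEnd ℂ (a i) * starRingEnd ℂ (b j) * ψ i j
      = ∑ k, (Real.sqrt (lam k) : ℂ) * ((∑ i, starRingEnd ℂ (a i) * u k i) *
        (∑ j, starRingEnd ℂ (b j) * v k j)) := by
  calc ∑ i, ∑ j, starRingEnd ℂ (a i) * starRingEnd ℂ (b j) * ψ i j
      = ∑ i, ∑ k, ∑ j, starRingEnd ℂ (a i) * starRingEnd ℂ (b j) *
          ((Real.sqrt (lam k) : ℂ) * u k i * v k j) := by
        refine Finset.sum_congr rfl fun i _ => ?_
        rw [Finset.sum_comm]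
        refine Finset.sum_congr rfl fun j _ => ?_
        rw [hψ, Finset.mul_sum]
    _ = ∑ k, ∑ i, ∑ j, starRingEnd ℂ (a i) * starRingEnd ℂ (b j) *
          ((Real.sqrt (lam k) : ℂ) * u k i * v k j) := Finset.sum_comm
    _ = _ := by
        refine Finset.sum_congr rfl fun k _ => ?_
        rw [Finset.sum_mul_sum, Finset.mul_sum]
        refine Finset.sum_congr rfl fun i _ => ?_
        rw [Finset.mul_sum]
        exact Finset.sum_congr rfl fun j _ => by ring

theorem aux_unit {d : ℕ} (w : Fin d → ℂ) (hw : ∑ i, starRingEnd ℂ (w i) * w i = 1) :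
    ∑ i, ‖w i‖ ^ 2 = 1 := by
  have : ((∑ i, ‖w i‖ ^ 2 : ℝ) : ℂ) = 1 := by
    rw [← hw]
    push_cast
    exact Finset.sum_congr rfl fun i _ => (Complex.conj_mul' (w i)).symm
  exact_mod_cast this

/-- The maximum Schmidt coefficient is the greatest squared overlap
of `ψ` with a unit product state. -/
theorem schmidt_coeff_isGreatest_overlap
    (dA dB r : ℕ) (hdA : 0 < dA) (hdB : 0 < dB) (hr : 0 < r)
    (lam : Fin r → ℝ) (hlam : ∀ k, 0 ≤ lam k) (hsum : ∑ k, lam k = 1)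
    (u : Fin r → Fin dA → ℂ) (v : Fin r → Fin dB → ℂ)
    (hu : ∀ k l, ∑ i, starRingEnd ℂ (u k i) * u l i = if k = l then 1 else 0)
    (hv : ∀ k l, ∑ j, starRingEnd ℂ (v k j) * v l j = if k = l then 1 else 0)
    (ψ : Fin dA → Fin dB → ℂ)
    (hψ : ∀ i j, ψ i j = ∑ k, (Real.sqrt (lam k) : ℂ) * u k i * v k j) :
    IsGreatest
      { x : ℝ | ∃ a : Fin dA → ℂ, ∃ b : Fin dB → ℂ,
          (∑ i, ‖a i‖ ^ 2 = 1) ∧ (∑ j, ‖b j‖ ^ 2 = 1) ∧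
          x = ‖∑ i, ∑ j, starRingEnd ℂ (a i) * starRingEnd ℂ (b j) * ψ i j‖ ^ 2 }
      (⨆ k, lam k) := by
  haveI : Nonempty (Fin r) := ⟨⟨0, hr⟩⟩
  have hbdd : BddAbove (Set.range lam) := (Set.finite_range lam).bddAbove
  constructor
  · obtain ⟨m, hm⟩ := exists_eq_ciSup_of_finite (f := lam)
    refine ⟨u m, v m, aux_unit _ (by simpa using hu m m), aux_unit _ (by simpa using hv m m), ?_⟩
    rw [aux_overlap lam u v ψ hψ, ← hm]
    simp only [hu, hv]
    simp [Real.sq_sqrt (hlam m)]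
  · rintro x ⟨a, b, ha, hb, rfl⟩
    rw [aux_overlap lam u v ψ hψ]
    have h1 := aux_bessel u hu a ha
    have h2 := aux_bessel v hv b hb
    set α := fun k => ∑ i, starRingEnd ℂ (a i) * u k i with hα
    set β := fun k => ∑ j, starRingEnd ℂ (b j) * v k j with hβ
    have hM : 0 ≤ ⨆ k, lam k := Real.iSup_nonneg hlam
    have key : ‖∑ k, (Real.sqrt (lam k) : ℂ) * (α k * β k)‖ ≤ Real.sqrt (⨆ k, lam k) := by
      calc ‖∑ k, (Real.sqrt (lam k) : ℂ) * (α k * β k)‖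
          ≤ ∑ k, ‖(Real.sqrt (lam k) : ℂ) * (α k * β k)‖ := norm_sum_le _ _
        _ ≤ ∑ k, Real.sqrt (⨆ k, lam k) * ((‖α k‖ ^ 2 + ‖β k‖ ^ 2) / 2) := by
            refine Finset.sum_le_sum fun k _ => ?_
            rw [norm_mul, norm_mul, Complex.norm_real, Real.norm_of_nonneg (Real.sqrt_nonneg _)]
            refine mul_le_mul (Real.sqrt_le_sqrt (le_ciSup hbdd k)) ?_ (by positivity)
              (Real.sqrt_nonneg _)
            nlinarith [sq_nonneg (‖α k‖ - ‖β k‖)]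
        _ = Real.sqrt (⨆ k, lam k) * ((∑ k, ‖α k‖ ^ 2 + ∑ k, ‖β k‖ ^ 2) / 2) := by
            rw [← Finset.mul_sum, ← Finset.sum_div, Finset.sum_add_distrib]
        _ ≤ Real.sqrt (⨆ k, lam k) * 1 := by
            refine mul_le_mul_of_nonneg_left ?_ (Real.sqrt_nonneg _)
            simp only [hα, hβ]
            linarith
        _ = _ := mul_one _
    calc _ ≤ Real.sqrt (⨆ k, lam k) ^ 2 := by
            exact pow_le_pow_left₀ (norm_nonneg _) key 2
      _ = _ := Real.sq_sqrt hM
end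

section
/- Let M : Matrix (Fin d_A) (Fin d_B) ℂ satisfy trace(M · Mᴴ) = 1 (a unit-norm bipartite pure state), and let ε ≥ 0. If for all unit vectors a ∈ ℂ^{d_A} and b ∈ ℂ^{d_B} one has |Σ_{i,j} conj(a_i) · M(i,j) · conj(b_j)|² ≤ 1 − ε², then the purity of the reduced density matrix satisfies Re trace((M · Mᴴ) · (M · Mᴴ)) ≤ 1 − ε². -/
open Matrix

lemma aux_trace {m n : ℕ} (A : Matrix (Fin m) (Fin n) ℂ) :
    (Matrix.trace (A * Aᴴ)).re = ∑ i, ∑ j, ‖A i j‖ ^ 2 := by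
  simp only [Matrix.trace, Matrix.diag, Matrix.mul_apply, Matrix.conjTranspose_apply,
    Complex.re_sum]
  refine Finset.sum_congr rfl fun i _ => Finset.sum_congr rfl fun j _ => ?_
  have h := Complex.mul_conj' (A i j)
  rw [← starRingEnd_apply, h]
  norm_cast

lemma aux_unit_s2 {n : ℕ} (v : Fin n → ℂ) (T : ℝ) (hT : 0 < T) (h : ∑ i, ‖v i‖ ^ 2 = T) :
    ∑ i, ‖((Real.sqrt T)⁻¹ : ℂ) * v i‖ ^ 2 = 1 := by
  have h1 : ∀ i, ‖((Real.sqrt T)⁻¹ : ℂ) * v i‖ ^ 2 = T⁻¹ * ‖v i‖ ^ 2 := by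
    intro i
    rw [norm_mul, mul_pow, norm_inv, Complex.norm_real, inv_pow, Real.norm_eq_abs, sq_abs,
      Real.sq_sqrt hT.le]
  simp only [h1]
  rw [← Finset.mul_sum, h, inv_mul_cancel₀ hT.ne']

lemma aux_key {dA dB : ℕ} (M : Matrix (Fin dA) (Fin dB) ℂ) (c : ℝ) (hc : 0 ≤ c)
    (hfar : ∀ a : Fin dA → ℂ, ∀ b : Fin dB → ℂ,
      (∑ i, ‖a i‖ ^ 2 = 1) → (∑ j, ‖b j‖ ^ 2 = 1) →
      ‖∑ i, ∑ j, starRingEnd ℂ (a i) * M i j * starRingEnd ℂ (b j)‖ ^ 2 ≤ c)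
    (v : Fin dA → ℂ) :
    ∑ j, ‖∑ i, starRingEnd ℂ (v i) * M i j‖ ^ 2 ≤ c * ∑ i, ‖v i‖ ^ 2 := by
  obtain ⟨w, hw⟩ : ∃ w : Fin dB → ℂ, w = fun j => ∑ i, starRingEnd ℂ (v i) * M i j := ⟨_, rfl⟩
  have hw' : ∀ j, ∑ i, starRingEnd ℂ (v i) * M i j = w j := fun j => by rw [hw]
  simp only [hw']
  obtain ⟨S, hS⟩ : ∃ S, ∑ j, ‖w j‖ ^ 2 = S := ⟨_, rfl⟩
  obtain ⟨T, hT⟩ : ∃ T, ∑ i, ‖v i‖ ^ 2 = T := ⟨_, rfl⟩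
  have hS0 : 0 ≤ S := hS ▸ Finset.sum_nonneg fun _ _ => by positivity
  have hT0 : 0 ≤ T := hT ▸ Finset.sum_nonneg fun _ _ => by positivity
  rw [hS, hT]
  rcases hS0.eq_or_lt with h | hSp
  · rw [← h]; positivity
  rcases hT0.eq_or_lt with h | hTp
  · exfalso
    rw [← h, Finset.sum_eq_zero_iff_of_nonneg (fun _ _ => by positivity)] at hT
    have hv : ∀ i, v i = 0 := fun i => by simpa using hT i (Finset.mem_univ i)
    have : S = 0 := by rw [← hS, hw]; simp [hv]
    linarith
  have key := hfar _ _ (aux_unit_s2 v T hTp hT) (aux_unit_s2 w S hSp hS)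
  have e : ∑ i, ∑ j, starRingEnd ℂ (((Real.sqrt T)⁻¹ : ℂ) * v i) * M i j *
      starRingEnd ℂ (((Real.sqrt S)⁻¹ : ℂ) * w j)
      = (((Real.sqrt T)⁻¹ * (Real.sqrt S)⁻¹ * S : ℝ) : ℂ) := by
    have hSc : (S : ℂ) = ∑ j, w j * starRingEnd ℂ (w j) := by
      rw [← hS]; push_cast
      exact Finset.sum_congr rfl fun j _ => (Complex.mul_conj' _).symm
    push_cast
    rw [Finset.sum_comm, hSc, Finset.mul_sum]
    refine Finset.sum_congr rfl fun j _ => ?_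
    have h2 : w j * starRingEnd ℂ (w j) =
        ∑ i, starRingEnd ℂ (v i) * M i j * starRingEnd ℂ (w j) := by
      rw [← Finset.sum_mul, hw' j]
    rw [h2, Finset.mul_sum]
    refine Finset.sum_congr rfl fun i _ => ?_
    simp only [map_mul, map_inv₀, Complex.conj_ofReal]
    ring
  rw [e, Complex.norm_real, Real.norm_eq_abs, sq_abs, mul_pow, mul_pow, inv_pow, inv_pow,
    Real.sq_sqrt hT0, Real.sq_sqrt hS0] at key
  have : T⁻¹ * S⁻¹ * S ^ 2 = S / T := by field_simp
  rw [this, div_le_iff₀ hTp] at key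
  exact key

/-- If a unit-norm bipartite pure state `M` has all squared overlaps
with unit product states at most `1 - ε²`, then the purity of its reduced
density matrix is at most `1 - ε²`. -/
theorem purity_le_of_far_from_product
    (dA dB : ℕ) (M : Matrix (Fin dA) (Fin dB) ℂ)
    (hM : Matrix.trace (M * Mᴴ) = 1)
    (ε : ℝ) (hε : 0 ≤ ε)
    (hfar : ∀ a : Fin dA → ℂ, ∀ b : Fin dB → ℂ,
      (∑ i, ‖a i‖ ^ 2 = 1) → (∑ j, ‖b j‖ ^ 2 = 1) →
      ‖∑ i, ∑ j, starRingEnd ℂ (a i) * M i j * starRingEnd ℂ (b j)‖ ^ 2 ≤ 1 - ε ^ 2) :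
    (Matrix.trace ((M * Mᴴ) * (M * Mᴴ))).re ≤ 1 - ε ^ 2 := by
  have hn : ∑ i, ∑ j, ‖M i j‖ ^ 2 = 1 := by rw [← aux_trace, hM]; simp
  have hc : 0 ≤ 1 - ε ^ 2 := by
    rcases Nat.eq_zero_or_pos dA with h | hA
    · subst h; simp at hn
    rcases Nat.eq_zero_or_pos dB with h | hB
    · subst h; simp at hn
    have := hfar (Pi.single ⟨0, hA⟩ 1) (Pi.single ⟨0, hB⟩ 1)
      (by rw [Finset.sum_eq_single ⟨0, hA⟩] <;> simp +contextual [Pi.single_apply])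
      (by rw [Finset.sum_eq_single ⟨0, hB⟩] <;> simp +contextual [Pi.single_apply])
    exact le_trans (by positivity) this
  have h1 : Matrix.trace ((M * Mᴴ) * (M * Mᴴ)) = Matrix.trace ((Mᴴ * M) * (Mᴴ * M)ᴴ) := by
    rw [Matrix.conjTranspose_mul, Matrix.conjTranspose_conjTranspose, Matrix.mul_assoc,
      Matrix.trace_mul_comm]
    simp only [Matrix.mul_assoc]
  rw [h1, aux_trace]
  calc _ ≤ ∑ k, (1 - ε ^ 2) * ∑ i, ‖M i k‖ ^ 2 := by
        refine Finset.sum_le_sum fun k _ => ?_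
        exact aux_key M _ hc hfar (fun i => M i k)
    _ = 1 - ε ^ 2 := by rw [← Finset.mul_sum, Finset.sum_comm, hn, mul_one]
end

section
/- Let G be a finite group, H a subgroup of G, d a natural number, and ρ : G →* U(d) a unitary representation of G by d×d complex unitary matrices. Then for every g ∈ G: Σ_{h ∈ H} Σ_{h' ∈ H} Σ_{i,j ∈ Fin d} ρ(g·h)(i,j) · conj(ρ(g·h')(i,j)) = |H| · Σ_{h ∈ H} trace(ρ(h)). (This computes the weak Fourier sampling outcome probability in the hidden subgroup problem: P_HSP[λ] = (d_λ/|G|) Σ_{h∈H} χ_λ(h), independently of the coset representative g.) -/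
/-- The weak Fourier sampling outcome probability in the hidden
subgroup problem, `∑_{h,h'∈H} ∑_{i,j} ρ(gh)_{ij} conj(ρ(gh')_{ij}) = |H| ∑_{h∈H} χ_ρ(h)`,
independently of the coset representative `g`. -/
theorem hsp_weak_fourier_sampling
    {G : Type*} [Group G] [Fintype G] (H : Subgroup G) [Fintype H]
    (d : ℕ) (ρ : G →* Matrix.unitaryGroup (Fin d) ℂ) (g : G) :
    ∑ h : H, ∑ h' : H, ∑ i : Fin d, ∑ j : Fin d,
        (ρ (g * (h : G)) : Matrix (Fin d) (Fin d) ℂ) i j *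
          starRingEnd ℂ ((ρ (g * (h' : G)) : Matrix (Fin d) (Fin d) ℂ) i j)
      = (Fintype.card H : ℂ) *
          ∑ h : H, Matrix.trace (ρ (h : G) : Matrix (Fin d) (Fin d) ℂ) := by
  have key : ∀ h h' : H, ∑ i : Fin d, ∑ j : Fin d,
        (ρ (g * (h : G)) : Matrix (Fin d) (Fin d) ℂ) i j *
          starRingEnd ℂ ((ρ (g * (h' : G)) : Matrix (Fin d) (Fin d) ℂ) i j)
      = Matrix.trace (ρ ((h * h'⁻¹ : H) : G) : Matrix (Fin d) (Fin d) ℂ) := by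
    intro h h'
    have h1 : ∑ i : Fin d, ∑ j : Fin d,
        (ρ (g * (h : G)) : Matrix (Fin d) (Fin d) ℂ) i j *
          starRingEnd ℂ ((ρ (g * (h' : G)) : Matrix (Fin d) (Fin d) ℂ) i j)
        = Matrix.trace ((ρ (g * (h : G)) * (ρ (g * (h' : G)))⁻¹ :
            Matrix.unitaryGroup (Fin d) ℂ) : Matrix (Fin d) (Fin d) ℂ) := rfl
    have h2 : ρ (g * (h : G)) * (ρ (g * (h' : G)))⁻¹
        = ρ g * (ρ ((h * h'⁻¹ : H) : G) * (ρ g)⁻¹) := by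
      rw [← map_inv, ← map_inv, ← map_mul, ← map_mul, ← map_mul]
      congr 1
      push_cast
      group
    rw [h1, h2, Submonoid.coe_mul, Matrix.trace_mul_comm, ← Submonoid.coe_mul,
      inv_mul_cancel_right]
  simp_rw [key]
  rw [Finset.sum_comm]
  have key2 : ∀ h' : H,
      ∑ h : H, Matrix.trace (ρ ((h * h'⁻¹ : H) : G) : Matrix (Fin d) (Fin d) ℂ)
      = ∑ h : H, Matrix.trace (ρ (h : G) : Matrix (Fin d) (Fin d) ℂ) := fun h' =>
    Equiv.sum_comp (Equiv.mulRight h'⁻¹)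
      (fun h : H => Matrix.trace (ρ (h : G) : Matrix (Fin d) (Fin d) ℂ))
  rw [Finset.sum_congr rfl (fun h' _ => key2 h'), Finset.sum_const, Finset.card_univ,
    nsmul_eq_mul]
end

section
/- Let G be a finite group, d_λ and d natural numbers, ρ : G →* U(d_λ) and R : G →* U(d) unitary representations, H a subgroup of G, and ψ ∈ ℂ^d a vector invariant under H, i.e., R(h)·ψ = ψ (matrix-vector product) for all h ∈ H. Let T be a complete set of left coset representatives of H in G, i.e., for every g ∈ G there is a unique c ∈ T with c⁻¹·g ∈ H. Then Σ_{g,g' ∈ G} Σ_{i,j ∈ Fin d_λ} ρ(g)(i,j) · conj(ρ(g')(i,j)) · ⟨ψ, R(g'⁻¹·g)·ψ⟩ = |G| · Σ_{c ∈ T} Σ_{h ∈ H} trace(ρ(c·h)) · ⟨ψ, R(c)·ψ⟩, where ⟨·,·⟩ is the standard Hermitian inner product on ℂ^d (conjugate-linear in the first argument). (This computes the weak Fourier sampling outcome probability in the state hidden subgroup problem: P_StateHSP[λ] = (d_λ/|G|) Σ_{c∈G/H} Σ_{h∈H} χ_λ(c h)·⟨ψ|R(c)|ψ⟩.) -/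
/-- The weak Fourier sampling outcome probability in the state
hidden subgroup problem:
`∑_{g,g'} ∑_{i,j} ρ(g)_{ij} conj(ρ(g')_{ij}) ⟨ψ, R(g'⁻¹g)ψ⟩
  = |G| ∑_{c∈T} ∑_{h∈H} χ_ρ(ch) ⟨ψ, R(c)ψ⟩`. -/
theorem statehsp_weak_fourier_sampling
    {G : Type*} [Group G] [Fintype G] (H : Subgroup G) [Fintype H]
    (dl d : ℕ) (ρ : G →* Matrix.unitaryGroup (Fin dl) ℂ)
    (R : G →* Matrix.unitaryGroup (Fin d) ℂ)
    (ψ : Fin d → ℂ)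
    (hψ : ∀ h ∈ H, Matrix.mulVec (R h : Matrix (Fin d) (Fin d) ℂ) ψ = ψ)
    (T : Finset G)
    (hT : ∀ g : G, ∃! c, c ∈ T ∧ c⁻¹ * g ∈ H) :
    ∑ g : G, ∑ g' : G, ∑ i : Fin dl, ∑ j : Fin dl,
        (ρ g : Matrix (Fin dl) (Fin dl) ℂ) i j *
          starRingEnd ℂ ((ρ g' : Matrix (Fin dl) (Fin dl) ℂ) i j) *
          (∑ x : Fin d, starRingEnd ℂ (ψ x) *
            Matrix.mulVec (R (g'⁻¹ * g) : Matrix (Fin d) (Fin d) ℂ) ψ x)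
      = (Fintype.card G : ℂ) *
          ∑ c ∈ T, ∑ h : H,
            Matrix.trace (ρ (c * (h : G)) : Matrix (Fin dl) (Fin dl) ℂ) *
              (∑ x : Fin d, starRingEnd ℂ (ψ x) *
                Matrix.mulVec (R c : Matrix (Fin d) (Fin d) ℂ) ψ x) := by
  set I : G → ℂ := fun k => ∑ x : Fin d, starRingEnd ℂ (ψ x) *
    Matrix.mulVec (R k : Matrix (Fin d) (Fin d) ℂ) ψ x with hI
  set F : G → ℂ := fun k => Matrix.trace (ρ k : Matrix (Fin dl) (Fin dl) ℂ) * I k with hF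
  have hIH : ∀ (c : G) (h : H), I (c * (h : G)) = I c := by
    intro c h
    simp only [hI, map_mul, Matrix.UnitaryGroup.mul_val, ← Matrix.mulVec_mulVec, hψ h h.2]
  have h1 : ∀ g g' : G, ∑ i : Fin dl, ∑ j : Fin dl,
        (ρ g : Matrix (Fin dl) (Fin dl) ℂ) i j *
          starRingEnd ℂ ((ρ g' : Matrix (Fin dl) (Fin dl) ℂ) i j) * I (g'⁻¹ * g)
        = F (g'⁻¹ * g) := by
    intro g g'
    simp only [hF, ← Finset.sum_mul]
    congr 1
    rw [map_mul, map_inv, Matrix.UnitaryGroup.mul_val, Matrix.UnitaryGroup.inv_val,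
      Matrix.trace_mul_comm]
    simp [Matrix.trace, Matrix.mul_apply, Matrix.star_apply]
  have h2 : ∑ g : G, ∑ g' : G, F (g'⁻¹ * g) = (Fintype.card G : ℂ) * ∑ k : G, F k := by
    rw [Finset.sum_comm]
    have : ∀ g' : G, ∑ g : G, F (g'⁻¹ * g) = ∑ k : G, F k := fun g' =>
      Equiv.sum_comp (Equiv.mulLeft g'⁻¹) F
    simp [this]
  have h3 : ∑ k : G, F k = ∑ c ∈ T, ∑ h : H, F (c * (h : G)) := by
    rw [← Finset.sum_product']
    symm
    refine Finset.sum_bij (fun p _ => p.1 * (p.2 : G)) (fun _ _ => Finset.mem_univ _) ?_ ?_ ?_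
    · rintro ⟨c, h⟩ hc ⟨c', h'⟩ hc' heq
      simp only [Finset.mem_product, Finset.mem_univ, and_true] at hc hc' heq
      have e : c = c' := (hT (c * h)).unique ⟨hc, by simp⟩ ⟨hc', by rw [heq]; simp⟩
      subst e
      have := mul_left_cancel heq
      rw [Subtype.ext this]
    · intro g _
      obtain ⟨c, ⟨hc, hg⟩, -⟩ := hT g
      exact ⟨(c, ⟨c⁻¹ * g, hg⟩), by simp [hc], by simp⟩
    · intros; rfl
  calc _ = ∑ g : G, ∑ g' : G, F (g'⁻¹ * g) :=
        Finset.sum_congr rfl fun g _ => Finset.sum_congr rfl fun g' _ => h1 g g'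
    _ = _ := by
        rw [h2, h3]
        simp only [hF, hIH]
        rfl
end

section
/- Let G be a finite group, d_λ and d natural numbers, ρ : G →* U(d_λ) and R : G →* U(d) unitary representations, H a subgroup of G, and ψ ∈ ℂ^d a vector with R(h)·ψ = ψ for all h ∈ H. Let T be a complete set of left coset representatives of H in G with 1 ∈ T, let ε ∈ [0,1] satisfy |⟨ψ, R(g)·ψ⟩| ≤ 1 − ε for all g ∉ H, and let t be a natural number. Then | (d_λ/|G|) · Σ_{c ∈ T, c ≠ 1} Σ_{h ∈ H} trace(ρ(c·h)) · ⟨ψ, R(c)·ψ⟩^t | ≤ d_λ² · (1 − |H|/|G|) · (1 − ε)^t. (Hence, when Fourier sampling uses t copies of the state, the StateHSP outcome distribution differs from the corresponding HSP distribution by at most d_λ²·exp(−εt) in each outcome.) -/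
/-- With `t` copies, the deviation of the StateHSP Fourier sampling
distribution from the HSP one is bounded by `d_λ² (1 - |H|/|G|) (1-ε)^t`. -/
theorem statehsp_fourier_sampling_amplified_bound
    {G : Type*} [Group G] [Fintype G] [DecidableEq G] (H : Subgroup G) [Fintype H]
    (dl d : ℕ) (ρ : G →* Matrix.unitaryGroup (Fin dl) ℂ)
    (R : G →* Matrix.unitaryGroup (Fin d) ℂ)
    (ψ : Fin d → ℂ)
    (hψ : ∀ h ∈ H, Matrix.mulVec (R h : Matrix (Fin d) (Fin d) ℂ) ψ = ψ)
    (T : Finset G) (h1T : (1 : G) ∈ T)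
    (hT : ∀ g : G, ∃! c, c ∈ T ∧ c⁻¹ * g ∈ H)
    (ε : ℝ) (hε0 : 0 ≤ ε) (hε1 : ε ≤ 1)
    (hg : ∀ g : G, g ∉ H →
      ‖∑ x : Fin d, starRingEnd ℂ (ψ x) *
          Matrix.mulVec (R g : Matrix (Fin d) (Fin d) ℂ) ψ x‖ ≤ 1 - ε)
    (t : ℕ) :
    ‖((dl : ℂ) / (Fintype.card G : ℂ)) *
        ∑ c ∈ T \ {1}, ∑ h : H,
          Matrix.trace (ρ (c * (h : G)) : Matrix (Fin dl) (Fin dl) ℂ) *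
            (∑ x : Fin d, starRingEnd ℂ (ψ x) *
              Matrix.mulVec (R c : Matrix (Fin d) (Fin d) ℂ) ψ x) ^ t‖
      ≤ (dl : ℝ) ^ 2 * (1 - (Fintype.card H : ℝ) / (Fintype.card G : ℝ)) *
          (1 - ε) ^ t := by
  have hcard : (T.card : ℝ) * (Fintype.card H : ℝ) = (Fintype.card G : ℝ) := by
    have hb : Function.Bijective (fun p : T × H => (p.1 : G) * (p.2 : G)) := by
      constructor
      · rintro ⟨⟨c, hc⟩, ⟨h, hh⟩⟩ ⟨⟨c', hc'⟩, ⟨h', hh'⟩⟩ heq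
        simp only at heq
        have hcc : c = c' := (hT (c * h)).unique ⟨hc, by simpa using hh⟩
          ⟨hc', by rw [heq]; simpa using hh'⟩
        subst hcc
        have hhh : h = h' := mul_left_cancel heq
        subst hhh
        rfl
      · intro g
        obtain ⟨c, ⟨hc, hcg⟩, -⟩ := hT g
        exact ⟨⟨⟨c, hc⟩, ⟨c⁻¹ * g, hcg⟩⟩, by simp⟩
    have := Fintype.card_of_bijective hb
    rw [Fintype.card_prod, Fintype.card_coe] at this
    exact_mod_cast this
  have htr : ∀ g : G, ‖Matrix.trace (ρ g : Matrix (Fin dl) (Fin dl) ℂ)‖ ≤ dl := by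
    intro g
    calc ‖Matrix.trace (ρ g : Matrix (Fin dl) (Fin dl) ℂ)‖
        ≤ ∑ i : Fin dl, (1 : ℝ) :=
          norm_sum_le_of_le _ fun i _ => entry_norm_bound_of_unitary (ρ g).2 i i
      _ = dl := by simp
  have hGpos : (0 : ℝ) < Fintype.card G := by exact_mod_cast Fintype.card_pos
  have hTc : ((T \ {1}).card : ℝ) = T.card - 1 := by
    rw [Finset.sdiff_singleton_eq_erase, Finset.cast_card_erase_of_mem h1T]
  have hsum : ‖∑ c ∈ T \ {1}, ∑ h : H,
          Matrix.trace (ρ (c * (h : G)) : Matrix (Fin dl) (Fin dl) ℂ) *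
            (∑ x : Fin d, starRingEnd ℂ (ψ x) *
              Matrix.mulVec (R c : Matrix (Fin d) (Fin d) ℂ) ψ x) ^ t‖
      ≤ ∑ c ∈ T \ {1}, ∑ h : H, (dl : ℝ) * (1 - ε) ^ t := by
    refine norm_sum_le_of_le _ fun c hc => norm_sum_le_of_le _ fun h _ => ?_
    rw [Finset.mem_sdiff, Finset.mem_singleton] at hc
    have hcH : c ∉ H := fun hcH =>
      hc.2 ((hT c).unique ⟨hc.1, by simp⟩ ⟨h1T, by simpa using hcH⟩)
    rw [norm_mul, norm_pow]
    exact mul_le_mul (htr _) (pow_le_pow_left₀ (norm_nonneg _) (hg c hcH) t)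
      (by positivity) (by positivity)
  rw [norm_mul, norm_div, Complex.norm_natCast, Complex.norm_natCast]
  refine (mul_le_mul_of_nonneg_left hsum (by positivity)).trans (le_of_eq ?_)
  simp only [Finset.sum_const, nsmul_eq_mul, Finset.card_univ]
  rw [hTc]
  field_simp
  rw [← hcard]
  ring
end

section
/- Let p and n be natural numbers. Then Σ over all Boolean matrices Y : Fin p → Fin n → Bool of [ (Π_{k ∈ Fin p, i ∈ Fin n} w(Y(k,i))) · (1/3)^{N(Y)} ] = ((2 + (1/2)^p)/3)^n, where w(true) = 1/4, w(false) = 3/4, and N(Y) is the number of columns i ∈ Fin n for which the number of rows k with Y(k,i) = true is odd. Equivalently: if y⁽¹⁾,…,y⁽ᵖ⁾ ∈ {0,1}^n are independent with each bit i.i.d. Bernoulli(1/4), then E[3^{−|y⁽¹⁾⊕⋯⊕y⁽ᵖ⁾|}] = ((2 + 2^{−p})/3)^n. -/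
lemma column_expectation (p : ℕ) :
    ∑ y : Fin p → Bool, (∏ k : Fin p, (if y k then (1/4 : ℝ) else 3/4)) *
      (if Odd (Finset.univ.filter fun k : Fin p => y k = true).card then (1/3 : ℝ) else 1)
      = (2 + (1/2 : ℝ) ^ p) / 3 := by
  have key : ∀ y : Fin p → Bool, (∏ k : Fin p, (if y k then (1/4 : ℝ) else 3/4)) *
      (if Odd (Finset.univ.filter fun k : Fin p => y k = true).card then (1/3 : ℝ) else 1)
      = 2/3 * (∏ k : Fin p, (if y k then (1/4 : ℝ) else 3/4))
        + 1/3 * (∏ k : Fin p, (if y k then (-(1/4) : ℝ) else 3/4)) := by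
    intro y
    have h1 : (∏ k : Fin p, (if y k then (-(1/4) : ℝ) else 3/4))
        = (-1) ^ (Finset.univ.filter fun k : Fin p => y k = true).card *
          ∏ k : Fin p, (if y k then (1/4 : ℝ) else 3/4) := by
      rw [← Finset.prod_const, Finset.prod_filter, ← Finset.prod_mul_distrib]
      refine Finset.prod_congr rfl fun k _ => ?_
      split_ifs <;> norm_num
    rw [h1]
    split_ifs with h
    · rw [h.neg_one_pow]; ring
    · rw [(Nat.not_odd_iff_even.mp h).neg_one_pow]; ring
  have e : ∀ f : Bool → ℝ, ∑ y : Fin p → Bool, ∏ k : Fin p, f (y k) = (f true + f false) ^ p := by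
    intro f
    rw [← Fintype.sum_bool, Fintype.sum_pow]
  rw [Finset.sum_congr rfl fun y _ => key y, Finset.sum_add_distrib, ← Finset.mul_sum,
    ← Finset.mul_sum, e (fun b => if b then (1/4 : ℝ) else 3/4),
    e (fun b => if b then (-(1/4) : ℝ) else 3/4)]
  norm_num
  ring

/-- If `y⁽¹⁾,…,y⁽ᵖ⁾ ∈ {0,1}ⁿ` have i.i.d. `Bernoulli(1/4)` bits,
then `E[3^{-|y⁽¹⁾ ⊕ ⋯ ⊕ y⁽ᵖ⁾|}] = ((2 + 2^{-p})/3)^n`. -/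
theorem bernoulli_xor_weight_expectation (p n : ℕ) :
    ∑ Y : Fin p → Fin n → Bool,
        (∏ k : Fin p, ∏ i : Fin n, (if Y k i then (1/4 : ℝ) else 3/4)) *
          (1/3 : ℝ) ^
            (Finset.univ.filter fun i : Fin n =>
              Odd (Finset.univ.filter fun k : Fin p => Y k i = true).card).card
      = ((2 + (1/2 : ℝ) ^ p) / 3) ^ n := by
  rw [← column_expectation p, Fintype.sum_pow]
  refine Fintype.sum_equiv (Equiv.piComm fun _ _ => Bool) _ _ fun Y => ?_
  rw [Finset.prod_comm, Finset.prod_mul_distrib, ← Finset.prod_const, Finset.prod_filter]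
  rfl
end

section
/- Let n be a natural number, V = Fin n → ZMod 2, and let P : V → ℝ be a probability mass function (P(v) ≥ 0 for all v and Σ_{v∈V} P(v) = 1). For each natural number p, define M_p = Σ_{y : Fin p → V} (Π_{i ∈ Fin p} P(y(i))) · P(Σ_{i ∈ Fin p} y(i)) (so M_0 = P(0)). Then for every natural number k, the probability that k i.i.d. samples from P are linearly independent over 𝔽₂ satisfies: Σ over tuples y : Fin k → V that are linearly independent over ZMod 2 of Π_{i ∈ Fin k} P(y(i)) ≥ 1 − Σ_{p=0}^{k−1} binom(k, p+1) · M_p. -/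
open scoped Classical

/-- Marginalisation: the event that the samples indexed by `S` sum to zero only involves `S`. -/
lemma xor_zero_marginal {V : Type} [Fintype V] [DecidableEq V] [AddCommGroup V] (P : V → ℝ)
    (hP1 : ∑ v, P v = 1) {k : ℕ} (S : Finset (Fin k)) :
    (∑ y : Fin k → V, (∏ i, P (y i)) * (if ∑ i ∈ S, y i = 0 then (1:ℝ) else 0)) =
    ∑ y : {i // i ∈ S} → V, (∏ i, P (y i)) * (if ∑ i, y i = 0 then (1:ℝ) else 0) := by
  have h1 : ∑ z : {i // ¬ i ∈ S} → V, ∏ i, P (z i) = 1 := by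
    rw [← Fintype.prod_sum (fun (_ : {i // ¬ i ∈ S}) v => P v)]
    simp [hP1]
  calc _ = ∑ q : ({i // i ∈ S} → V) × ({i // ¬ i ∈ S} → V),
        ((∏ i, P (q.1 i)) * (if ∑ i, q.1 i = 0 then (1:ℝ) else 0)) * ∏ i, P (q.2 i) := by
        apply Fintype.sum_equiv (Equiv.piEquivPiSubtypeProd (fun i => i ∈ S) (fun _ => V))
        intro y
        have e1 : ∑ i ∈ S, y i = ∑ i : {i // i ∈ S}, y i := (Finset.sum_coe_sort S y).symm
        have e2 : (∏ i : {i // i ∈ S}, P (y i)) * ∏ i : {i // ¬ i ∈ S}, P (y i)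
            = ∏ i, P (y i) := by
          convert Fintype.prod_subtype_mul_prod_subtype (fun i => i ∈ S) (fun i => P (y i))
        simp only [Equiv.piEquivPiSubtypeProd_apply]
        rw [e1, ← e2]
        ring
    _ = _ := by
        rw [Fintype.sum_prod_type]
        refine Finset.sum_congr rfl fun y _ => ?_
        have h3 := Finset.mul_sum Finset.univ (fun z : {i // ¬ i ∈ S} → V => ∏ i, P (z i))
          ((∏ i, P (y i)) * (if ∑ i, y i = 0 then (1:ℝ) else 0))
        rw [h1, mul_one] at h3
        exact h3.symm

/-- The probability that `p + 1` samples sum to zero is the XOR moment of order `p`. -/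
lemma xor_zero_moment {V : Type} [Fintype V] [DecidableEq V] [AddCommGroup V] (P : V → ℝ)
    (h2 : ∀ a b : V, a + b = 0 ↔ a = b) (p : ℕ) {ι : Type} [Fintype ι] [DecidableEq ι]
    (hι : Fintype.card ι = p + 1) :
    (∑ y : ι → V, (∏ i, P (y i)) * (if ∑ i, y i = 0 then (1:ℝ) else 0)) =
    ∑ y : Fin p → V, (∏ i, P (y i)) * P (∑ i, y i) := by
  let e : ι ≃ Fin (p + 1) := Fintype.equivFinOfCardEq hι
  calc _ = ∑ y : Fin (p + 1) → V, (∏ i, P (y i)) * (if ∑ i, y i = 0 then (1:ℝ) else 0) := by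
        apply Fintype.sum_equiv (e.arrowCongr (Equiv.refl V))
        intro y
        have e1 : ∏ i, P (y i) = ∏ i, P (y (e.symm i)) :=
          (Equiv.prod_comp e.symm (fun i => P (y i))).symm
        have e2 : ∑ i, y i = ∑ i, y (e.symm i) := (Equiv.sum_comp e.symm y).symm
        rw [e1, e2]
        rfl
    _ = ∑ q : V × (Fin p → V), (P q.1 * ∏ i, P (q.2 i)) *
          (if q.1 + ∑ i, q.2 i = 0 then (1:ℝ) else 0) := by
        symm
        apply Fintype.sum_equiv (Fin.consEquiv (fun _ => V))
        rintro ⟨a, y⟩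
        simp [Fin.consEquiv, Fin.prod_univ_succ, Fin.sum_univ_succ]
    _ = _ := by
        rw [Fintype.sum_prod_type_right]
        refine Finset.sum_congr rfl fun y _ => ?_
        simp only [h2, mul_ite, mul_one, mul_zero]
        rw [Finset.sum_ite_eq' Finset.univ]
        simp [mul_comm]

/-- A dependent family over `𝔽₂` has a nonempty subfamily with zero sum. -/
lemma exists_zero_sum {V : Type} [AddCommGroup V] [Module (ZMod 2) V] {k : ℕ} (y : Fin k → V)
    (h : ¬ LinearIndependent (ZMod 2) y) : ∃ S : Finset (Fin k), S.Nonempty ∧ ∑ i ∈ S, y i = 0 := by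
  rw [Fintype.not_linearIndependent_iff] at h
  obtain ⟨g, hg, i, hi⟩ := h
  refine ⟨Finset.univ.filter (fun i => g i ≠ 0), ⟨i, by simp [hi]⟩, ?_⟩
  rw [← hg, Finset.sum_filter]
  refine Finset.sum_congr rfl fun j _ => ?_
  have hz : ∀ a : ZMod 2, a = 0 ∨ a = 1 := by decide
  rcases hz (g j) with h | h <;> simp [h]

/-- Lower bound on the probability that `k` i.i.d. samples from a
distribution `P` on `𝔽₂ⁿ` are linearly independent, in terms of the XOR moments
`M_p = E[P(y⁽¹⁾ ⊕ ⋯ ⊕ y⁽ᵖ⁾)]`. -/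
theorem iid_samples_linear_independent_lower_bound
    (n : ℕ) (P : (Fin n → ZMod 2) → ℝ)
    (hP0 : ∀ v, 0 ≤ P v) (hP1 : ∑ v, P v = 1)
    (M : ℕ → ℝ)
    (hM : ∀ p, M p = ∑ y : Fin p → (Fin n → ZMod 2),
        (∏ i, P (y i)) * P (∑ i, y i))
    (k : ℕ) :
    1 - ∑ p ∈ Finset.range k, (k.choose (p + 1) : ℝ) * M p ≤
      ∑ y ∈ Finset.univ.filter
          (fun y : Fin k → (Fin n → ZMod 2) => LinearIndependent (ZMod 2) y),
        ∏ i, P (y i) := by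
  have h2 : ∀ a b : Fin n → ZMod 2, a + b = 0 ↔ a = b := by
    have hz : ∀ a b : ZMod 2, a + b = 0 ↔ a = b := by decide
    intro a b
    simp only [funext_iff, Pi.add_apply, Pi.zero_apply, hz]
  have htot : ∑ y : Fin k → (Fin n → ZMod 2), ∏ i, P (y i) = 1 := by
    rw [← Fintype.prod_sum (fun (_ : Fin k) v => P v)]
    simp [hP1]
  let g : ℕ → ℝ := fun j => if j = 0 then 0 else M (j - 1)
  have hS : ∀ S : Finset (Fin k), (if S.Nonempty then
      (∑ y : Fin k → (Fin n → ZMod 2), (∏ i, P (y i)) *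
        (if ∑ i ∈ S, y i = 0 then (1:ℝ) else 0)) else 0) = g S.card := by
    intro S
    by_cases hne : S.Nonempty
    · have hc : S.card ≠ 0 := hne.card_pos.ne'
      rw [if_pos hne, xor_zero_marginal P hP1 S,
        xor_zero_moment P h2 (S.card - 1) (ι := {i // i ∈ S}) (by rw [Fintype.card_coe]; omega)]
      simp only [g, if_neg hc, hM]
    · rw [if_neg hne]
      rw [Finset.not_nonempty_iff_eq_empty] at hne
      simp [hne, g]
  have hsum : ∑ S : Finset (Fin k), g S.card
      = ∑ p ∈ Finset.range k, (k.choose (p + 1) : ℝ) * M p := by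
    rw [← Finset.powerset_univ, Finset.sum_powerset_apply_card, Finset.card_univ, Fintype.card_fin,
      Finset.sum_range_succ']
    simp [g]
  rw [Finset.sum_filter, ← hsum, ← htot, sub_le_iff_le_add]
  simp only [← hS]
  have hpt : ∀ y : Fin k → (Fin n → ZMod 2), ∏ i, P (y i) ≤
      (if LinearIndependent (ZMod 2) y then ∏ i, P (y i) else 0) +
      ∑ S : Finset (Fin k), (if S.Nonempty then (∏ i, P (y i)) *
        (if ∑ i ∈ S, y i = 0 then (1:ℝ) else 0) else 0) := by
    intro y
    have hp : 0 ≤ ∏ i, P (y i) := Finset.prod_nonneg fun i _ => hP0 _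
    have hnn : ∀ S ∈ (Finset.univ : Finset (Finset (Fin k))),
        0 ≤ (if S.Nonempty then (∏ i, P (y i)) *
        (if ∑ i ∈ S, y i = 0 then (1:ℝ) else 0) else 0) := by
      intro S _
      split_ifs <;> simp [hp]
    by_cases h : LinearIndependent (ZMod 2) y
    · rw [if_pos h]
      exact le_add_of_nonneg_right (Finset.sum_nonneg hnn)
    · obtain ⟨S, h1, h0⟩ := exists_zero_sum y h
      rw [if_neg h, zero_add]
      refine le_trans ?_ (Finset.single_le_sum hnn (Finset.mem_univ S))
      simp [h1, h0]
  refine (Finset.sum_le_sum fun y _ => hpt y).trans (le_of_eq ?_)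
  rw [Finset.sum_add_distrib]
  congr 1
  rw [Finset.sum_comm]
  refine Finset.sum_congr rfl fun S _ => ?_
  split_ifs <;> simp
end
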